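/- arXiv:1407.4093 — 3 statements merged into one kernel-verified Lean document; each statement's English description precedes it below -/
import Mathlib

section
/- Let φ : [0,∞) → ℝ be positive with φ(x) = O(x) as x → ∞ and 1/φ locally integrable, and suppose τ_φ(x) := ∫₀^x dw/φ(w) is a strictly increasing bijection of [0,∞) onto [0,∞) with inverse σ, and put g := φ ∘ σ. Then φ is self-equivarying with index ρ ≥ 0 if and only if g(y + s)/g(y) → e^{ρs} as y → ∞ for every s ≥ 0. In particular, φ is self-neglecting (index ρ = 0) if and only if g(y + s)/g(y) → 1 as y → ∞ for every s ≥ 0. -/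
open Filter Topology MeasureTheory

/-- A function `φ : ℝ → ℝ` is *self-equivarying* with index `ρ`:
`φ` is eventually positive, `φ(x) = O(x)` at infinity, and
`φ(x + t φ(x))/φ(x) → 1 + ρ t` locally uniformly in `t ∈ [0,∞)`. -/
def IsSelfEquivarying (φ : ℝ → ℝ) (ρ : ℝ) : Prop :=
  (∀ᶠ x in atTop, 0 < φ x) ∧
  (φ =O[atTop] fun x => x) ∧
  ∀ T > 0, TendstoUniformlyOn (fun x t => φ (x + t * φ x) / φ x)
    (fun t => 1 + ρ * t) atTop (Set.Icc 0 T)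

/-- The occupation time `τ_φ(x) = ∫₀^x dw/φ(w)`. -/
noncomputable def tauPhi (φ : ℝ → ℝ) (x : ℝ) : ℝ :=
  ∫ w in (0:ℝ)..x, 1 / φ w

/-- The uniform convergence theorem for additively slowly varying functions: if all increments of
a measurable function tend to `0`, then they do so uniformly on compact sets of increments. -/
theorem eventually_forall_abs_sub_lt_of_aemeasurable {h : ℝ → ℝ} (hm : AEMeasurable h)
    (hh : ∀ s ≥ (0 : ℝ), Tendsto (fun y => h (y + s) - h y) atTop (𝓝 0)) (S : ℝ)
    {ε : ℝ} (hε : 0 < ε) :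
    ∀ᶠ y in atTop, ∀ s ∈ Set.Icc 0 S, |h (y + s) - h y| < ε := by
  by_contra hcon
  obtain ⟨y, hy, hbad⟩ := exists_seq_forall_of_frequently (not_eventually.1 hcon)
  push Not at hbad
  choose s hs hbad using hbad
  have meas : ∀ c d : ℝ, ∀ μ : Measure ℝ, μ ≪ volume →
      AEStronglyMeasurable (fun u => h (c + u) - d) μ := fun c d μ hμ =>
    (((hm.comp_quasiMeasurePreserving
      (measurePreserving_add_left volume c).quasiMeasurePreserving).sub_const d).mono_ac
        hμ).aestronglyMeasurable
  have ev : ∀ z : ℕ → ℝ, Tendsto z atTop atTop → ∀ a : ℝ, ∀ᶠ n in atTop,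
      volume ({u | ε / 2 ≤ ‖h (z n + u) - h (z n) - 0‖} ∩ Set.Icc 0 a) < 1 / 2 := by
    intro z hz a
    have key : TendstoInMeasure (volume.restrict (Set.Icc 0 a))
        (fun n u => h (z n + u) - h (z n)) atTop (fun _ => 0) := by
      refine tendstoInMeasure_of_tendsto_ae
        (fun n => meas _ _ _ Measure.absolutelyContinuous_restrict) ?_
      filter_upwards [ae_restrict_mem measurableSet_Icc] with u hu
      exact (hh u hu.1).comp hz
    have := tendstoInMeasure_iff_norm.1 key (ε / 2) (half_pos hε)
    filter_upwards [this.eventually_lt_const (by simp : (0 : ENNReal) < 1 / 2)] with n hn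
    exact (Measure.le_restrict_apply _ _).trans_lt hn
  have hys : Tendsto (fun n => y n + s n) atTop atTop :=
    tendsto_atTop_mono (fun n => le_add_of_nonneg_right (hs n).1) hy
  obtain ⟨n, hA, hB⟩ := ((ev y hy (S + 1)).and (ev _ hys 1)).exists
  set A := {u | ε / 2 ≤ ‖h (y n + u) - h (y n) - 0‖} ∩ Set.Icc 0 (S + 1)
  set B := {u | ε / 2 ≤ ‖h (y n + s n + u) - h (y n + s n) - 0‖} ∩ Set.Icc 0 1
  have hsub : Set.Icc (0 : ℝ) 1 ⊆ (fun u => u + s n) ⁻¹' A ∪ B := by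
    intro v hv
    by_contra hnot
    simp only [Set.mem_union, Set.mem_preimage, not_or, A, B, Set.mem_inter_iff,
      Set.mem_ofPred_eq, not_and'] at hnot
    have h1 := hnot.1 ⟨by linarith [hv.1, (hs n).1], by linarith [hv.2, (hs n).2]⟩
    have h2 := hnot.2 hv
    rw [not_le, Real.norm_eq_abs, sub_zero, abs_lt] at h1 h2
    have h3 := hbad n
    rw [show y n + (v + s n) = y n + s n + v by ring] at h1
    have : |h (y n + s n) - h (y n)| < ε := abs_lt.2 ⟨by linarith, by linarith⟩
    linarith
  have hle := (measure_mono (μ := volume) hsub).trans (measure_union_le _ _)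
  rw [measure_preimage_add_right, Real.volume_Icc, sub_zero, ENNReal.ofReal_one] at hle
  exact absurd (ENNReal.add_lt_add hA hB) (by simpa [ENNReal.inv_two_add_inv_two] using hle)

/-- `σ` inverts the occupation time of the positive function `φ` on `[0, ∞)`. -/
structure IsOccupationInverse (φ σ : ℝ → ℝ) : Prop where
  pos : ∀ x ≥ (0:ℝ), 0 < φ x
  locInt : LocallyIntegrableOn (fun w => 1 / φ w) (Set.Ici 0)
  mono : StrictMonoOn (tauPhi φ) (Set.Ici 0)
  bij : Set.BijOn (tauPhi φ) (Set.Ici 0) (Set.Ici 0)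
  left : ∀ x ≥ (0:ℝ), σ (tauPhi φ x) = x
  right : ∀ y ≥ (0:ℝ), tauPhi φ (σ y) = y

namespace IsOccupationInverse

variable {φ σ : ℝ → ℝ}

theorem nonneg (h : IsOccupationInverse φ σ) {y : ℝ} (hy : 0 ≤ y) : 0 ≤ σ y := by
  obtain ⟨x, hx, rfl⟩ := h.bij.surjOn hy
  rwa [h.left x hx]

theorem tau_nonneg (h : IsOccupationInverse φ σ) {x : ℝ} (hx : 0 ≤ x) : 0 ≤ tauPhi φ x :=
  h.bij.mapsTo hx

theorem le_iff (h : IsOccupationInverse φ σ) {y b : ℝ} (hy : 0 ≤ y) (hb : 0 ≤ b) :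
    σ y ≤ b ↔ y ≤ tauPhi φ b := by
  rw [← h.mono.le_iff_le (h.nonneg hy) hb, h.right y hy]

theorem lt_iff (h : IsOccupationInverse φ σ) {y a : ℝ} (hy : 0 ≤ y) (ha : 0 ≤ a) :
    a < σ y ↔ tauPhi φ a < y := by
  rw [← h.mono.lt_iff_lt ha (h.nonneg hy), h.right y hy]

theorem strictMonoOn (h : IsOccupationInverse φ σ) : StrictMonoOn σ (Set.Ici 0) :=
  fun a ha b hb hab => (h.lt_iff hb (h.nonneg ha)).2 (by rwa [h.right a ha])

theorem tendsto_atTop (h : IsOccupationInverse φ σ) : Tendsto σ atTop atTop := by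
  refine Filter.tendsto_atTop.2 fun b => ?_
  filter_upwards [eventually_gt_atTop (tauPhi φ (max b 0)), eventually_ge_atTop 0] with y hy h0
  exact (le_max_left _ _).trans ((h.lt_iff h0 (le_max_right _ _)).2 hy).le

theorem tau_tendsto_atTop (h : IsOccupationInverse φ σ) : Tendsto (tauPhi φ) atTop atTop := by
  refine Filter.tendsto_atTop.2 fun b => ?_
  filter_upwards [eventually_ge_atTop (σ (max b 0)), eventually_ge_atTop 0] with x hx h0
  exact (le_max_left _ _).trans ((h.le_iff (le_max_right _ _) h0).1 hx)

theorem intervalIntegrable (h : IsOccupationInverse φ σ) {a b : ℝ} (ha : 0 ≤ a) (hab : a ≤ b) :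
    IntervalIntegrable (fun w => 1 / φ w) volume a b := by
  refine (h.locInt.integrableOn_compact_subset ?_ isCompact_uIcc).intervalIntegrable
  rw [Set.uIcc_of_le hab]
  exact fun x hx => ha.trans hx.1

theorem tau_sub (h : IsOccupationInverse φ σ) {a b : ℝ} (ha : 0 ≤ a) (hab : a ≤ b) :
    tauPhi φ b - tauPhi φ a = ∫ w in a..b, 1 / φ w :=
  intervalIntegral.integral_interval_sub_left (h.intervalIntegrable le_rfl (ha.trans hab))
    (h.intervalIntegrable le_rfl ha)

theorem aemeasurable_one_div (h : IsOccupationInverse φ σ) :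
    AEMeasurable (fun w => 1 / φ w) (volume.restrict (Set.Ioi 0)) :=
  (h.locInt.aestronglyMeasurable.aemeasurable).mono_set Set.Ioi_subset_Ici_self

theorem aemeasurable (h : IsOccupationInverse φ σ) :
    AEMeasurable φ (volume.restrict (Set.Ioi 0)) := by
  exact h.aemeasurable_one_div.inv.congr (ae_of_all _ fun w => by simp)

theorem aemeasurable_inverse (h : IsOccupationInverse φ σ) :
    AEMeasurable σ (volume.restrict (Set.Ioi 0)) :=
  aemeasurable_restrict_of_monotoneOn measurableSet_Ioi
    (h.strictMonoOn.monotoneOn.mono Set.Ioi_subset_Ici_self)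

theorem map_eq_withDensity (h : IsOccupationInverse φ σ) :
    (volume.restrict (Set.Ioi 0)).map σ =
      (volume.restrict (Set.Ioi 0)).withDensity fun w => ENNReal.ofReal (1 / φ w) := by
  have key : ∀ a b : ℝ, a < b → (volume.restrict (Set.Ioi 0)).map σ (Set.Ioc a b) =
      ENNReal.ofReal (tauPhi φ (max b 0) - tauPhi φ (max a 0)) := by
    intro a b hab
    rw [Measure.map_apply_of_aemeasurable h.aemeasurable_inverse measurableSet_Ioc,
      Measure.restrict_apply' measurableSet_Ioi, ← Real.volume_Ioc]
    congr 1
    ext y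
    have hb := h.tau_nonneg (le_max_right b 0)
    have ha := h.tau_nonneg (le_max_right a 0)
    have h0 : tauPhi φ 0 = 0 := intervalIntegral.integral_same
    simp only [Set.mem_inter_iff, Set.mem_preimage, Set.mem_Ioc, Set.mem_Ioi]
    have hpos : 0 < y → 0 < σ y := fun hy => (h.lt_iff hy.le le_rfl).2 (by rwa [h0])
    constructor
    · rintro ⟨⟨h1, h2⟩, hy⟩
      exact ⟨(h.lt_iff hy.le (le_max_right _ _)).1 (max_lt h1 (hpos hy)),
        (h.le_iff hy.le (le_max_right _ _)).1 (h2.trans (le_max_left _ _))⟩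
    · rintro ⟨h1, h2⟩
      have hy : 0 < y := ha.trans_lt h1
      have h3 := (h.le_iff hy.le (le_max_right _ _)).2 h2
      refine ⟨⟨(le_max_left _ _).trans_lt ((h.lt_iff hy.le (le_max_right _ _)).2 h1), ?_⟩, hy⟩
      rcases le_max_iff.1 h3 with h4 | h4
      · exact h4
      · exact absurd (hpos hy) h4.not_gt
  refine Measure.ext_of_Ioc' _ _ (fun a b hab => ?_) fun a b hab => ?_
  · rw [key a b hab]
    exact ENNReal.ofReal_ne_top
  · have hle : max a 0 ≤ max b 0 := max_le_max hab.le le_rfl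
    have hset : Set.Ioc a b ∩ Set.Ioi 0 = Set.Ioc (max a 0) (max b 0) := by
      ext w
      simp only [Set.mem_inter_iff, Set.mem_Ioc, Set.mem_Ioi, max_lt_iff, le_max_iff]
      constructor
      · tauto
      · rintro ⟨⟨h1, h2⟩, h3⟩
        exact ⟨⟨h1, h3.resolve_right h2.not_ge⟩, h2⟩
    have h_int := h.intervalIntegrable (le_max_right a 0) hle
    rw [intervalIntegrable_iff_integrableOn_Ioc_of_le hle] at h_int
    rw [key a b hab, h.tau_sub (le_max_right a 0) hle, withDensity_apply _ measurableSet_Ioc,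
      Measure.restrict_restrict measurableSet_Ioc, hset, intervalIntegral.integral_of_le hle]
    refine ofReal_integral_eq_lintegral_ofReal h_int ?_
    filter_upwards [ae_restrict_mem measurableSet_Ioc] with w hw
    exact one_div_nonneg.2 (h.pos w ((le_max_right a 0).trans hw.1.le)).le

theorem aemeasurable_comp (h : IsOccupationInverse φ σ) :
    AEMeasurable (φ ∘ σ) (volume.restrict (Set.Ioi 0)) := by
  refine AEMeasurable.comp_aemeasurable ?_ h.aemeasurable_inverse
  rw [h.map_eq_withDensity]
  exact h.aemeasurable.mono_ac (withDensity_absolutelyContinuous _ _)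

theorem integral_comp (h : IsOccupationInverse φ σ) {a b : ℝ} (ha : 0 ≤ a) (hab : a ≤ b) :
    IntervalIntegrable (φ ∘ σ) volume a b ∧ ∫ y in a..b, (φ ∘ σ) y = σ b - σ a := by
  have hb := ha.trans hab
  have hσ : σ a ≤ σ b := h.strictMonoOn.monotoneOn ha hb hab
  have hset : σ ⁻¹' (Set.Ioc (σ a) (σ b)) ∩ Set.Ioi 0 = Set.Ioc a b := by
    ext y
    simp only [Set.mem_inter_iff, Set.mem_preimage, Set.mem_Ioc, Set.mem_Ioi]
    constructor
    · rintro ⟨⟨h1, h2⟩, hy⟩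
      exact ⟨(h.strictMonoOn.lt_iff_lt ha hy.le).1 h1, (h.strictMonoOn.le_iff_le hy.le hb).1 h2⟩
    · rintro ⟨h1, h2⟩
      have hy : 0 < y := ha.trans_lt h1
      exact ⟨⟨h.strictMonoOn ha hy.le h1, h.strictMonoOn.monotoneOn hy.le hb h2⟩, hy⟩
  have hset' : Set.Ioc (σ a) (σ b) ∩ Set.Ioi 0 = Set.Ioc (σ a) (σ b) :=
    Set.inter_eq_left.2 fun w hw => (h.nonneg ha).trans_lt hw.1
  have hd : AEMeasurable (fun w => ENNReal.ofReal (1 / φ w))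
      (volume.restrict (Set.Ioc (σ a) (σ b))) :=
    h.aemeasurable_one_div.ennreal_ofReal.mono_set (Set.inter_eq_left.1 hset')
  have hdt : ∀ᵐ w ∂(volume.restrict (Set.Ioc (σ a) (σ b))), ENNReal.ofReal (1 / φ w) < ⊤ :=
    ae_of_all _ fun _ => ENNReal.ofReal_lt_top
  have hone : (fun w => (ENNReal.ofReal (1 / φ w)).toReal • φ w)
      =ᵐ[volume.restrict (Set.Ioc (σ a) (σ b))] fun _ => (1 : ℝ) := by
    filter_upwards [ae_restrict_mem measurableSet_Ioc] with w hw
    have := h.pos w ((h.nonneg ha).trans hw.1.le)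
    rw [ENNReal.toReal_ofReal (one_div_nonneg.2 this.le), smul_eq_mul, one_div_mul_cancel this.ne']
  have hmeas : (volume.restrict (Set.Ioc a b)).map σ =
      (volume.restrict (Set.Ioc (σ a) (σ b))).withDensity fun w => ENNReal.ofReal (1 / φ w) := by
    rw [← hset', ← Measure.restrict_restrict measurableSet_Ioc, ← restrict_withDensity
      measurableSet_Ioc, ← h.map_eq_withDensity, Measure.restrict_map_of_aemeasurable
      h.aemeasurable_inverse measurableSet_Ioc, Measure.restrict_restrict' measurableSet_Ioi, hset]
  have hsm : AEMeasurable σ (volume.restrict (Set.Ioc a b)) :=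
    h.aemeasurable_inverse.mono_set fun y hy => ha.trans_lt hy.1
  have hφm : AEStronglyMeasurable φ ((volume.restrict (Set.Ioc a b)).map σ) := by
    rw [hmeas]
    exact ((h.aemeasurable.mono_set (Set.inter_eq_left.1 hset')).mono_ac
      (withDensity_absolutelyContinuous _ _)).aestronglyMeasurable
  rw [intervalIntegrable_iff_integrableOn_Ioc_of_le hab, intervalIntegral.integral_of_le hab]
  constructor
  · rw [IntegrableOn, ← integrable_map_measure hφm hsm, hmeas,
      integrable_withDensity_iff_integrable_smul₀' hd hdt, integrable_congr hone]
    simp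
  · change ∫ y in Set.Ioc a b, φ (σ y) = _
    rw [← integral_map hsm hφm, hmeas, integral_withDensity_eq_integral_toReal_smul₀ hd hdt,
      integral_congr_ae hone]
    simp [hσ]

end IsOccupationInverse

/-- The primitive of `t ↦ 1 / (1 + ρ t)` vanishing at `0`. -/
noncomputable def logIntegral (ρ t : ℝ) : ℝ :=
  if ρ = 0 then t else Real.log (1 + ρ * t) / ρ

theorem hasDerivAt_logIntegral {ρ t : ℝ} (ht : 0 < 1 + ρ * t) :
    HasDerivAt (logIntegral ρ) (1 / (1 + ρ * t)) t := by
  by_cases hρ : ρ = 0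
  · have : logIntegral ρ = id := by
      funext t
      simp [logIntegral, hρ]
    rw [this]
    simpa [hρ] using hasDerivAt_id t
  · have : logIntegral ρ = fun t => Real.log (1 + ρ * t) / ρ := by
      funext t
      simp [logIntegral, hρ]
    rw [this]
    refine (((((hasDerivAt_id t).const_mul ρ).const_add 1).log ht.ne').div_const ρ).congr_deriv ?_
    rw [mul_one, div_right_comm, div_self hρ, id]

theorem exp_mul_logIntegral {ρ t : ℝ} (hρ : 0 ≤ ρ) (ht : 0 ≤ t) :
    Real.exp (ρ * logIntegral ρ t) = 1 + ρ * t := by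
  by_cases h : ρ = 0
  · simp [h]
  · rw [logIntegral, if_neg h, mul_div_cancel₀ _ h, Real.exp_log (by positivity)]

theorem exists_lt_logIntegral {ρ : ℝ} (hρ : 0 ≤ ρ) (s : ℝ) : ∃ T > 0, s < logIntegral ρ T := by
  rcases hρ.eq_or_lt with rfl | h
  · exact ⟨|s| + 1, by positivity,
      by simpa [logIntegral] using (le_abs_self s).trans_lt (lt_add_one _)⟩
  · have hT : 0 < Real.exp (ρ * s) / ρ := by positivity
    refine ⟨_, hT, ?_⟩
    have := exp_mul_logIntegral hρ hT.le
    rw [mul_div_cancel₀ _ h.ne'] at this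
    have h1 : Real.exp (ρ * s) < Real.exp (ρ * logIntegral ρ (Real.exp (ρ * s) / ρ)) := by
      linarith
    exact lt_of_mul_lt_mul_left (Real.exp_lt_exp.1 h1) hρ

theorem exp_mul_eq_one_add_mul_integral (ρ s : ℝ) :
    Real.exp (ρ * s) = 1 + ρ * ∫ v in (0:ℝ)..s, Real.exp (ρ * v) := by
  rw [← intervalIntegral.integral_const_mul, intervalIntegral.integral_eq_sub_of_hasDerivAt
    (f := fun v => Real.exp (ρ * v)) (fun v _ => ?_)
    (Continuous.intervalIntegrable (by fun_prop) _ _)]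
  · simp
  · simpa [mul_comm] using ((hasDerivAt_id v).const_mul ρ).exp

theorem le_integral_exp {ρ s : ℝ} (hρ : 0 ≤ ρ) (hs : 0 ≤ s) :
    s ≤ ∫ v in (0:ℝ)..s, Real.exp (ρ * v) := by
  calc s = ∫ _ in (0:ℝ)..s, (1 : ℝ) := by simp
    _ ≤ _ := intervalIntegral.integral_mono_on hs (by simp)
      (Continuous.intervalIntegrable (by fun_prop) _ _)
      fun v hv => Real.one_le_exp (mul_nonneg hρ hv.1)

theorem integral_one_div_eq_logIntegral {ρ c x b : ℝ} (hρ : 0 ≤ ρ) (hc : 0 < c) (hxb : x ≤ b) :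
    IntervalIntegrable (fun w => 1 / (c * (1 + ρ * ((w - x) / c)))) volume x b ∧
    ∫ w in x..b, 1 / (c * (1 + ρ * ((w - x) / c))) = logIntegral ρ ((b - x) / c) := by
  have hone : ∀ w ∈ Set.uIcc x b, 0 < 1 + ρ * ((w - x) / c) := by
    intro w hw
    rw [Set.uIcc_of_le hxb] at hw
    have : 0 ≤ ρ * ((w - x) / c) := mul_nonneg hρ (div_nonneg (sub_nonneg.2 hw.1) hc.le)
    linarith
  have h_int : IntervalIntegrable (fun w => 1 / (c * (1 + ρ * ((w - x) / c)))) volume x b := by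
    refine ContinuousOn.intervalIntegrable (ContinuousOn.div (by fun_prop) (by fun_prop) ?_)
    exact fun w hw => (mul_pos hc (hone w hw)).ne'
  refine ⟨h_int, ?_⟩
  rw [intervalIntegral.integral_eq_sub_of_hasDerivAt
    (f := fun w => logIntegral ρ ((w - x) / c)) (fun w hw => ?_) h_int]
  · simp [logIntegral]
  · refine ((hasDerivAt_logIntegral (hone w hw)).comp w
      (((hasDerivAt_id w).sub_const x).div_const c)).congr_deriv ?_
    rw [div_mul_div_comm, mul_one, mul_comm c]

theorem abs_one_div_sub_one_div_le {a b η : ℝ} (hb : 1 ≤ b) (hη : η ≤ 1 / 2)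
    (hab : |a - b| < η) : |1 / a - 1 / b| ≤ 2 * η := by
  have h1 := abs_lt.1 hab
  have ha : 1 / 2 ≤ a := by linarith
  have ha0 : 0 < a := by linarith
  have hb0 : 0 < b := by linarith
  rw [div_sub_div _ _ ha0.ne' hb0.ne', abs_div, abs_of_pos (mul_pos ha0 hb0),
    div_le_iff₀ (mul_pos ha0 hb0), show 1 * b - a * 1 = -(a - b) by ring, abs_neg]
  have hprod : 1 / 2 ≤ a * b := by nlinarith
  have hη0 : 0 < η := (abs_nonneg _).trans_lt hab
  nlinarith

namespace IsOccupationInverse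

variable {φ σ : ℝ → ℝ}

theorem eventually_abs_tau_sub_lt (h : IsOccupationInverse φ σ) {ρ : ℝ} (hρ : 0 ≤ ρ)
    (hφ : IsSelfEquivarying φ ρ) {T ε : ℝ} (hT : 0 < T) (hε : 0 < ε) :
    ∀ᶠ x in atTop, ∀ t ∈ Set.Icc 0 T,
      |tauPhi φ (x + t * φ x) - tauPhi φ x - logIntegral ρ t| < ε := by
  set η := min (1 / 2) (ε / (4 * T))
  have hη : 0 < η := lt_min (by norm_num) (by positivity)
  filter_upwards [Metric.tendstoUniformlyOn_iff.1 (hφ.2.2 T hT) η hη, eventually_ge_atTop 0]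
    with x hx h0 t ht
  have hc := h.pos x h0
  have hb : x ≤ x + t * φ x := le_add_of_nonneg_right (mul_nonneg ht.1 hc.le)
  obtain ⟨h_int, hval⟩ := integral_one_div_eq_logIntegral hρ hc hb
  rw [add_sub_cancel_left, mul_div_cancel_right₀ _ hc.ne'] at hval
  rw [h.tau_sub h0 hb, ← hval, ← intervalIntegral.integral_sub (h.intervalIntegrable h0 hb) h_int]
  have hle : ‖∫ w in x..x + t * φ x, (1 / φ w - 1 / (φ x * (1 + ρ * ((w - x) / φ x))))‖ ≤
      2 * η / φ x * |x + t * φ x - x| := by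
    refine intervalIntegral.norm_integral_le_of_norm_le_const fun w hw => ?_
    rw [Set.uIoc_of_le hb] at hw
    have hu0 : 0 ≤ (w - x) / φ x := div_nonneg (sub_nonneg.2 hw.1.le) hc.le
    have hut : (w - x) / φ x ≤ t := by
      rw [div_le_iff₀ hc]
      linarith [hw.2]
    have hd := hx _ ⟨hu0, hut.trans ht.2⟩
    rw [div_mul_cancel₀ _ hc.ne', add_sub_cancel, dist_comm, Real.dist_eq] at hd
    have hle := abs_one_div_sub_one_div_le (le_add_of_nonneg_right (mul_nonneg hρ hu0))
      (min_le_left _ _) hd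
    have heq : 1 / φ w - 1 / (φ x * (1 + ρ * ((w - x) / φ x))) =
        (1 / (φ w / φ x) - 1 / (1 + ρ * ((w - x) / φ x))) / φ x := by
      generalize (w - x) / φ x = u
      rw [sub_div, one_div_div, div_right_comm, div_self hc.ne', div_div 1, mul_comm (φ x)]
    rw [heq, norm_div, Real.norm_eq_abs, Real.norm_eq_abs, abs_of_pos hc]
    gcongr
  rw [add_sub_cancel_left, abs_of_nonneg (mul_nonneg ht.1 hc.le)] at hle
  calc _ ≤ 2 * η / φ x * (t * φ x) := hle
    _ = 2 * η * t := by field_simp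
    _ ≤ 2 * (ε / (4 * T)) * T := by
      gcongr
      · exact ht.1
      · exact min_le_right _ _
      · exact ht.2
    _ = ε / 2 := by field_simp; norm_num
    _ < ε := half_lt_self hε

theorem exists_increment (h : IsOccupationInverse φ σ) {y s : ℝ} (hy : 0 ≤ y) (hs : 0 ≤ s) :
    ∃ t ≥ 0, σ y + t * φ (σ y) = σ (y + s) := by
  have hc := h.pos _ (h.nonneg hy)
  refine ⟨(σ (y + s) - σ y) / φ (σ y), div_nonneg (sub_nonneg.2 ?_) hc.le, ?_⟩
  · exact h.strictMonoOn.monotoneOn hy (add_nonneg hy hs) (le_add_of_nonneg_right hs)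
  · rw [div_mul_cancel₀ _ hc.ne', add_sub_cancel]

theorem tendsto_of_isSelfEquivarying (h : IsOccupationInverse φ σ) {ρ : ℝ} (hρ : 0 ≤ ρ)
    (hφ : IsSelfEquivarying φ ρ) {s : ℝ} (hs : 0 ≤ s) :
    Tendsto (fun y => (φ ∘ σ) (y + s) / (φ ∘ σ) y) atTop (𝓝 (Real.exp (ρ * s))) := by
  have hex : ∀ y, ∃ t, 0 ≤ y → 0 ≤ t ∧ σ y + t * φ (σ y) = σ (y + s) := fun y => by
    by_cases hy : 0 ≤ y
    · obtain ⟨t, ht⟩ := h.exists_increment hy hs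
      exact ⟨t, fun _ => ht⟩
    · exact ⟨0, fun h' => absurd h' hy⟩
  choose t ht using hex
  obtain ⟨T, hT, hsT⟩ := exists_lt_logIntegral hρ s
  have htT : ∀ᶠ y in atTop, t y ∈ Set.Icc 0 T := by
    filter_upwards [h.tendsto_atTop.eventually
      (h.eventually_abs_tau_sub_lt hρ hφ hT (sub_pos.2 hsT)), eventually_ge_atTop 0] with y hy h0
    have hc := h.pos _ (h.nonneg h0)
    have h1 := (abs_lt.1 (hy T ⟨hT.le, le_rfl⟩)).1
    rw [h.right y h0] at h1
    refine ⟨(ht y h0).1, ?_⟩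
    have h2 := (h.le_iff (b := σ y + T * φ (σ y)) (add_nonneg h0 hs)
      (add_nonneg (h.nonneg h0) (mul_nonneg hT.le hc.le))).2 (by linarith)
    rw [← (ht y h0).2, add_le_add_iff_left, mul_le_mul_iff_left₀ hc] at h2
    exact h2
  have hL : Tendsto (fun y => logIntegral ρ (t y)) atTop (𝓝 s) := by
    rw [Metric.tendsto_nhds]
    intro ε hε
    filter_upwards [h.tendsto_atTop.eventually (h.eventually_abs_tau_sub_lt hρ hφ hT hε),
      eventually_ge_atTop 0, htT] with y hy h0 hty
    have h1 := hy _ hty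
    rw [(ht y h0).2, h.right y h0, h.right _ (add_nonneg h0 hs), add_sub_cancel_left] at h1
    rwa [dist_comm, Real.dist_eq]
  have hE : Tendsto (fun y => 1 + ρ * t y) atTop (𝓝 (Real.exp (ρ * s))) := by
    refine ((hL.const_mul ρ).rexp).congr' ?_
    filter_upwards [htT] with y hy
    exact exp_mul_logIntegral hρ hy.1
  have hR : Tendsto (fun y => (φ ∘ σ) (y + s) / (φ ∘ σ) y - (1 + ρ * t y)) atTop (𝓝 0) := by
    rw [Metric.tendsto_nhds]
    intro ε hε
    filter_upwards [h.tendsto_atTop.eventually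
      (Metric.tendstoUniformlyOn_iff.1 (hφ.2.2 T hT) ε hε), eventually_ge_atTop 0, htT]
      with y hy h0 hty
    have h1 := hy _ hty
    rw [(ht y h0).2, dist_comm, Real.dist_eq] at h1
    rwa [dist_zero_right]
  simpa using hR.add hE

theorem eventually_abs_ratio_sub_lt (h : IsOccupationInverse φ σ) {ρ : ℝ} (hρ : 0 ≤ ρ)
    (hg : ∀ s ≥ (0:ℝ), Tendsto (fun y => (φ ∘ σ) (y + s) / (φ ∘ σ) y) atTop
      (𝓝 (Real.exp (ρ * s)))) (S : ℝ) {ε : ℝ} (hε : 0 < ε) :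
    ∀ᶠ y in atTop, ∀ s ∈ Set.Icc 0 S, |φ (σ (y + s)) / φ (σ y) - Real.exp (ρ * s)| < ε := by
  have hgpos : ∀ y ≥ 0, 0 < φ (σ y) := fun y hy => h.pos _ (h.nonneg hy)
  set H : ℝ → ℝ := (Set.Ioi 0).indicator fun y => Real.log ((φ ∘ σ) y) - ρ * y with hH
  have hHval : ∀ y > 0, H y = Real.log (φ (σ y)) - ρ * y := fun y hy =>
    Set.indicator_of_mem (Set.mem_Ioi.2 hy) _
  have hHexp : ∀ y > 0, ∀ s ≥ 0,
      φ (σ (y + s)) / φ (σ y) = Real.exp (ρ * s) * Real.exp (H (y + s) - H y) := by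
    intro y hy s hs
    rw [hHval y hy, hHval _ (add_pos_of_pos_of_nonneg hy hs), ← Real.exp_add,
      show ρ * s + (Real.log (φ (σ (y + s))) - ρ * (y + s) - (Real.log (φ (σ y)) - ρ * y)) =
        Real.log (φ (σ (y + s))) - Real.log (φ (σ y)) by ring, Real.exp_sub,
      Real.exp_log (hgpos _ (by positivity)), Real.exp_log (hgpos _ hy.le)]
  have hHm : AEMeasurable H := (aemeasurable_indicator_iff measurableSet_Ioi).2
    ((Real.measurable_log.comp_aemeasurable h.aemeasurable_comp).sub (by fun_prop))
  have hHt : ∀ s ≥ (0 : ℝ), Tendsto (fun y => H (y + s) - H y) atTop (𝓝 0) := by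
    intro s hs
    have h1 := ((hg s hs).log (Real.exp_pos _).ne').sub_const (ρ * s)
    rw [Real.log_exp, sub_self] at h1
    refine h1.congr' ?_
    filter_upwards [eventually_gt_atTop 0] with y hy
    change Real.log (φ (σ (y + s)) / φ (σ y)) - ρ * s = _
    rw [hHexp y hy s hs, ← Real.exp_add, Real.log_exp, add_sub_cancel_left]
  have hcont : Tendsto (fun z => |Real.exp (ρ * S) * (Real.exp z - 1)|) (𝓝 0) (𝓝 0) := by
    have : Continuous fun z => |Real.exp (ρ * S) * (Real.exp z - 1)| := by fun_prop
    simpa using this.tendsto 0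
  obtain ⟨δ, hδ, hδε⟩ := Metric.eventually_nhds_iff.1 (hcont.eventually_lt_const hε)
  filter_upwards [eventually_forall_abs_sub_lt_of_aemeasurable hHm hHt S hδ,
    eventually_gt_atTop 0] with y hy h0 s hs
  have h1 := hδε (y := H (y + s) - H y) (by simpa using hy s hs)
  rw [hHexp y h0 s hs.1]
  refine lt_of_le_of_lt ?_ h1
  rw [← mul_sub_one, abs_mul, abs_mul, Real.abs_exp, Real.abs_exp]
  gcongr
  exact hs.2

theorem eventually_abs_inverse_sub_lt (h : IsOccupationInverse φ σ) {ρ : ℝ} (hρ : 0 ≤ ρ)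
    (hg : ∀ s ≥ (0:ℝ), Tendsto (fun y => (φ ∘ σ) (y + s) / (φ ∘ σ) y) atTop
      (𝓝 (Real.exp (ρ * s)))) {S ε : ℝ} (hS : 0 < S) (hε : 0 < ε) :
    ∀ᶠ y in atTop, ∀ s ∈ Set.Icc 0 S,
      |(σ (y + s) - σ y) / φ (σ y) - ∫ v in (0:ℝ)..s, Real.exp (ρ * v)| < ε := by
  filter_upwards [h.eventually_abs_ratio_sub_lt hρ hg S (ε := ε / (2 * S)) (by positivity),
    eventually_ge_atTop 0] with y hy h0 s hs
  obtain ⟨h_int, hval⟩ := h.integral_comp h0 (le_add_of_nonneg_right hs.1 : y ≤ y + s)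
  have h_int' : IntervalIntegrable (fun v => φ (σ (y + v)) / φ (σ y)) volume 0 s := by
    have := h_int.comp_add_left y
    rw [sub_self, add_sub_cancel_left] at this
    exact this.div_const _
  have hval' : ∫ v in (0:ℝ)..s, φ (σ (y + v)) / φ (σ y) = (σ (y + s) - σ y) / φ (σ y) := by
    rw [intervalIntegral.integral_div, ← hval,
      intervalIntegral.integral_comp_add_left (fun v => φ (σ v)), add_zero]
    rfl
  rw [← hval', ← intervalIntegral.integral_sub h_int'
    (Continuous.intervalIntegrable (by fun_prop) _ _)]
  have hle : ‖∫ v in (0:ℝ)..s, (φ (σ (y + v)) / φ (σ y) - Real.exp (ρ * v))‖ ≤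
      ε / (2 * S) * |s - 0| := by
    refine intervalIntegral.norm_integral_le_of_norm_le_const fun v hv => ?_
    rw [Set.uIoc_of_le hs.1] at hv
    exact (hy v ⟨hv.1.le, hv.2.trans hs.2⟩).le
  rw [sub_zero, abs_of_nonneg hs.1] at hle
  calc _ ≤ ε / (2 * S) * s := hle
    _ ≤ ε / (2 * S) * S := by gcongr; exact hs.2
    _ = ε / 2 := by field_simp
    _ < ε := half_lt_self hε

theorem isSelfEquivarying_of_tendsto (h : IsOccupationInverse φ σ) {ρ : ℝ} (hρ : 0 ≤ ρ)
    (hO : φ =O[atTop] fun x => x)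
    (hg : ∀ s ≥ (0:ℝ), Tendsto (fun y => (φ ∘ σ) (y + s) / (φ ∘ σ) y) atTop
      (𝓝 (Real.exp (ρ * s)))) : IsSelfEquivarying φ ρ := by
  refine ⟨(eventually_ge_atTop 0).mono h.pos, hO, fun T hT => ?_⟩
  rw [Metric.tendstoUniformlyOn_iff]
  intro ε hε
  have hS : 0 < T + 1 := by linarith
  have hη : 0 < ε / (2 * (ρ + 1)) := by positivity
  filter_upwards [h.tau_tendsto_atTop.eventually
      (h.eventually_abs_inverse_sub_lt hρ hg hS (lt_min one_pos hη)),
    h.tau_tendsto_atTop.eventually (h.eventually_abs_ratio_sub_lt hρ hg (T + 1) (half_pos hε)),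
    eventually_ge_atTop 0] with x hE hR h0 t ht
  have hc := h.pos x h0
  have hxt : x ≤ x + t * φ x := le_add_of_nonneg_right (mul_nonneg ht.1 hc.le)
  have hτ := h.tau_nonneg h0
  have hτt := h.tau_nonneg (h0.trans hxt)
  rw [h.left x h0] at hE hR
  set s := tauPhi φ (x + t * φ x) - tauPhi φ x with hs
  have hσs : σ (tauPhi φ x + s) = x + t * φ x := by
    rw [hs, add_sub_cancel, h.left _ (h0.trans hxt)]
  have hs0 : 0 ≤ s := sub_nonneg.2 (h.mono.monotoneOn h0 (h0.trans hxt) hxt)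
  have hsS : s ≤ T + 1 := by
    by_contra! hlt
    have h1 := (abs_lt.1 (hE (T + 1) ⟨hS.le, le_rfl⟩)).1
    have h2 := le_integral_exp hρ hS.le
    have h3 : σ (tauPhi φ x + (T + 1)) ≤ x + t * φ x :=
      (h.le_iff (add_nonneg hτ hS.le) (h0.trans hxt)).2 (by linarith)
    have h4 : (σ (tauPhi φ x + (T + 1)) - x) / φ x ≤ t := by
      rw [div_le_iff₀ hc]
      linarith
    linarith [min_le_left 1 (ε / (2 * (ρ + 1))), ht.2]
  have hE' := hE s ⟨hs0, hsS⟩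
  have hR' := hR s ⟨hs0, hsS⟩
  rw [hσs] at hE' hR'
  rw [add_sub_cancel_left, mul_div_cancel_right₀ _ hc.ne'] at hE'
  rw [exp_mul_eq_one_add_mul_integral] at hR'
  have hE'' := hE'.trans_le (min_le_right _ _)
  have hmul : |ρ * (t - ∫ v in (0:ℝ)..s, Real.exp (ρ * v))| ≤ ε / 2 := by
    rw [abs_mul, abs_of_nonneg hρ]
    calc _ ≤ (ρ + 1) * (ε / (2 * (ρ + 1))) := by gcongr; linarith
      _ = ε / 2 := by field_simp
  rw [Real.dist_eq]
  have h1 := abs_lt.1 hR'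
  have h2 := abs_le.1 hmul
  rw [abs_lt]
  constructor <;> linarith [h1.1, h1.2, h2.1, h2.2]

theorem isSelfEquivarying_iff (h : IsOccupationInverse φ σ) {ρ : ℝ} (hρ : 0 ≤ ρ)
    (hO : φ =O[atTop] fun x => x) :
    IsSelfEquivarying φ ρ ↔ ∀ s ≥ (0:ℝ),
      Tendsto (fun y => (φ ∘ σ) (y + s) / (φ ∘ σ) y) atTop (𝓝 (Real.exp (ρ * s))) :=
  ⟨fun hφ _ hs => h.tendsto_of_isSelfEquivarying hρ hφ hs, h.isSelfEquivarying_of_tendsto hρ hO⟩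

end IsOccupationInverse

/-- `φ` is self-equivarying with index `ρ ≥ 0` iff its time-changed version
`g = φ ∘ σ` (with `σ` the inverse of the occupation time `τ_φ`) is additively
regularly varying with multiplicative Karamata index `ρ`, i.e.
`g(y + s)/g(y) → e^{ρ s}` for every `s ≥ 0`. In particular `φ` is self-neglecting
(index `ρ = 0`) iff `g(y + s)/g(y) → 1` for every `s ≥ 0`. -/
theorem se_iff_time_changed_regularly_varying (φ : ℝ → ℝ) (ρ : ℝ) (hρ : 0 ≤ ρ)
    (hpos : ∀ x ≥ (0:ℝ), 0 < φ x)
    (hO : φ =O[atTop] fun x => x)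
    (hloc : LocallyIntegrableOn (fun w => 1 / φ w) (Set.Ici 0))
    (σ : ℝ → ℝ)
    (hmono : StrictMonoOn (tauPhi φ) (Set.Ici 0))
    (hbij : Set.BijOn (tauPhi φ) (Set.Ici 0) (Set.Ici 0))
    (hσ : ∀ x ≥ (0:ℝ), σ (tauPhi φ x) = x)
    (hσ' : ∀ y ≥ (0:ℝ), tauPhi φ (σ y) = y) :
    (IsSelfEquivarying φ ρ ↔
      ∀ s ≥ (0:ℝ), Tendsto (fun y => (φ ∘ σ) (y + s) / (φ ∘ σ) y) atTop
        (nhds (Real.exp (ρ * s)))) ∧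
    (IsSelfEquivarying φ 0 ↔
      ∀ s ≥ (0:ℝ), Tendsto (fun y => (φ ∘ σ) (y + s) / (φ ∘ σ) y) atTop (nhds 1)) := by
  have h : IsOccupationInverse φ σ := ⟨hpos, hloc, hmono, hbij, hσ, hσ'⟩
  exact ⟨h.isSelfEquivarying_iff hρ hO, by simpa using h.isSelfEquivarying_iff le_rfl hO⟩
end

section
/- Let f_n, f : ℝ → ℝ with f upper semicontinuous, and suppose there is a comeagre set S ⊆ ℝ such that for every t ∈ S both f_n(t) → f(t) and the one-sided limsup-sup condition holds: f(t) = lim_{δ↓0} limsup_{n→∞} sup{ f_n(s) : s ∈ [t, t + δ) }. Then there is a comeagre set T ⊆ ℝ such that for every t ∈ T the two-sided condition holds: f(t) = lim_{δ↓0} limsup_{n→∞} sup{ f_n(s) : s ∈ (t − δ, t + δ) }. -/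
open Filter Topology

/-- The `limsup`-`sup` functional: `limsup_{n→∞} sup { F n s : s ∈ I }`, valued in `EReal`. -/
noncomputable def limsupSupOn (F : ℕ → ℝ → ℝ) (I : Set ℝ) : EReal :=
  Filter.limsup (fun n => ⨆ s ∈ I, ((F n s : ℝ) : EReal)) Filter.atTop

theorem limsupSupOn_mono (F : ℕ → ℝ → ℝ) {I J : Set ℝ} (h : I ⊆ J) :
    limsupSupOn F I ≤ limsupSupOn F J :=
  limsup_le_limsup (.of_forall fun _ => biSup_mono h)

/-- A set of reals each of whose points is isolated from the right is nowhere dense. -/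
theorem isNowhereDense_of_disjoint_Ioo {A : Set ℝ}
    (hA : ∀ t ∈ A, ∃ δ > 0, Disjoint (Set.Ioo t (t + δ)) A) : IsNowhereDense A := by
  rw [IsNowhereDense, Set.eq_empty_iff_forall_notMem]
  intro x hx
  obtain ⟨t, htW, htA⟩ :=
    mem_closure_iff.1 (interior_subset hx) _ isOpen_interior hx
  obtain ⟨δ, hδ, hdisj⟩ := hA t htA
  have hright : ∀ᶠ y in 𝓝[>] t, y ∈ interior (closure A) ∧ y ∈ Set.Ioo t (t + δ) :=
    inter_mem (mem_nhdsWithin_of_mem_nhds (isOpen_interior.mem_nhds htW))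
      (Ioo_mem_nhdsGT (by linarith))
  obtain ⟨y, hyW, hyI⟩ := hright.exists
  obtain ⟨z, hzI, hzA⟩ := mem_closure_iff.1 (interior_subset hyW) _ isOpen_Ioo hyI
  exact Set.disjoint_left.1 hdisj hzI hzA

/-- Uniform upper semicontinuity (Proposition 4): if `f` is upper semicontinuous and,
quasi everywhere (on a comeagre set `S`), `F n t → f t` pointwise and the one-sided
limsup-sup condition
`f(t) = lim_{δ↓0} limsup_n sup { F n s : s ∈ [t, t+δ) }` holds, then quasi everywhere
the corresponding two-sided condition
`f(t) = lim_{δ↓0} limsup_n sup { F n s : s ∈ (t−δ, t+δ) }` holds. -/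
theorem uniform_upper_semicontinuity (F : ℕ → ℝ → ℝ) (f : ℝ → ℝ)
    (hf : UpperSemicontinuous f)
    (S : Set ℝ) (hS : IsMeagre Sᶜ)
    (hpt : ∀ t ∈ S, Tendsto (fun n => F n t) atTop (nhds (f t)))
    (hone : ∀ t ∈ S,
      Tendsto (fun δ : ℝ => limsupSupOn F (Set.Ico t (t + δ)))
        (nhdsWithin 0 (Set.Ioi 0)) (nhds ((f t : EReal)))) :
    ∃ T : Set ℝ, IsMeagre Tᶜ ∧ ∀ t ∈ T,
      Tendsto (fun δ : ℝ => limsupSupOn F (Set.Ioo (t - δ) (t + δ)))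
        (nhdsWithin 0 (Set.Ioi 0)) (nhds ((f t : EReal))) := by
  let A : ℚ → Set ℝ := fun q =>
    {t | t ∈ S ∧ (f t : EReal) < ((q : ℝ) : EReal) ∧
      ∀ δ > 0, ¬ limsupSupOn F (Set.Ioo (t - δ) (t + δ)) < ((q : ℝ) : EReal)}
  have hA (q : ℚ) : IsNowhereDense (A q) := by
    refine isNowhereDense_of_disjoint_Ioo fun t ⟨htS, htq, _⟩ => ?_
    obtain ⟨δ, hδq, hδ⟩ :=
      (((hone t htS).eventually_lt_const htq).and self_mem_nhdsWithin).exists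
    refine ⟨δ, hδ, Set.disjoint_left.2 fun s hs hsA => ?_⟩
    refine hsA.2.2 (min (s - t) (t + δ - s))
      (lt_min (sub_pos.2 hs.1) (sub_pos.2 hs.2)) ((limsupSupOn_mono F ?_).trans_lt hδq)
    intro y hy
    have h₁ := min_le_left (s - t) (t + δ - s)
    have h₂ := min_le_right (s - t) (t + δ - s)
    exact ⟨by linarith [hy.1], by linarith [hy.2]⟩
  refine ⟨S \ ⋃ q, A q, ?_, ?_⟩
  · rw [Set.sdiff_eq, Set.compl_inter, compl_compl]
    exact hS.union (isMeagre_iUnion fun q => (hA q).isMeagre)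
  · rintro t ⟨htS, htA⟩
    refine tendsto_order.2 ⟨fun a ha => ?_, fun a ha => ?_⟩
    · filter_upwards [(hone t htS).eventually_const_lt ha, self_mem_nhdsWithin] with δ hδ hpos
      exact hδ.trans_le (limsupSupOn_mono F
        (Set.Ico_subset_Ioo_left (sub_lt_self t hpos)))
    · obtain ⟨q, hq, hqa⟩ := EReal.lt_iff_exists_rat_btwn.1 ha
      have hex : ∃ δ > 0, limsupSupOn F (Set.Ioo (t - δ) (t + δ)) < ((q : ℝ) : EReal) := by
        by_contra! h
        exact htA (Set.mem_iUnion.2 ⟨q, htS, hq, fun δ hδ => (h δ hδ).not_gt⟩)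
      obtain ⟨δ, hδ, hlt⟩ := hex
      filter_upwards [Ioo_mem_nhdsGT hδ] with ε hε
      exact (limsupSupOn_mono F (Set.Ioo_subset_Ioo (by linarith [hε.2])
        (by linarith [hε.2]))).trans_lt (hlt.trans hqa)
end

section
/- Let φ : ℝ → ℝ be self-equivarying with index ρ > 0 and let h : ℝ → ℝ be a Baire function (preimages of open sets have the Baire property). If A^φ contains a non-meagre subset with the Baire property, then A^φ = G₊^ρ = (−1/ρ, ∞), and there is c ∈ ℝ such that K(u) = c·log(1 + ρu) for all u ∈ G₊^ρ (so K is a continuous homomorphism from (G₊^ρ, ∘_ρ) to (ℝ, +)). -/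
open Filter Topology

/-- A function is Baire if preimages of open sets have the Baire property. -/
def BaireFun (h : ℝ → ℝ) : Prop :=
  ∀ U : Set ℝ, IsOpen U → BaireMeasurableSet (h ⁻¹' U)

/-- `A^φ`: the set of `t > ρ*` at which `Δ_t^φ h` converges to a finite limit. -/
def Aphi (φ h : ℝ → ℝ) (ρ : ℝ) : Set ℝ :=
  {t | 0 < 1 + ρ * t ∧
    ∃ L : ℝ, Tendsto (fun x => h (x + t * φ x) - h x) atTop (nhds L)}

theorem IsSelfEquivarying.tendsto_div {φ : ℝ → ℝ} {ρ : ℝ} (hρ : 0 < ρ)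
    (hφ : IsSelfEquivarying φ ρ) : Tendsto (fun x => φ x / x) atTop (𝓝 ρ) := by
  obtain ⟨hpos, hO, hU⟩ := hφ
  obtain ⟨C, hC0, hC⟩ := hO.exists_pos
  rw [Asymptotics.isBigOWith_iff] at hC
  rw [Metric.tendsto_atTop]
  intro η hη
  obtain ⟨ε, hε0, hερ, hεη⟩ : ∃ ε > 0, ε ≤ ρ ∧ ε * (1 + C) ≤ η / 2 := by
    refine ⟨min ρ (η / 2 / (1 + C)), by positivity, min_le_left _ _, ?_⟩
    rw [← le_div_iff₀ (by positivity)]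
    exact min_le_right _ _
  obtain ⟨X, hX⟩ := eventually_atTop.1 (hpos.and (hC.and
    (Metric.tendstoUniformlyOn_iff.1 (hU 1 one_pos) ε hε0)))
  have hstep : ∀ x ≥ X, ∀ t ∈ Set.Icc (0 : ℝ) 1,
      |(φ (x + t * φ x) - ρ * (x + t * φ x)) - (φ x - ρ * x)| ≤ ε * φ x := by
    intro x hx t ht
    obtain ⟨h1, -, h3⟩ := hX x hx
    have h4 := h3 t ht
    rw [Real.dist_eq, abs_sub_comm] at h4
    have h5 : (φ (x + t * φ x) - ρ * (x + t * φ x)) - (φ x - ρ * x)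
        = (φ (x + t * φ x) / φ x - (1 + ρ * t)) * φ x := by
      field_simp
      ring
    rw [h5, abs_mul, abs_of_pos h1]
    exact mul_le_mul_of_nonneg_right h4.le h1.le
  set x₀ := max X 1 with hx₀
  let x : ℕ → ℝ := fun n => (fun y => y + φ y)^[n] x₀
  have hxs : ∀ n, x (n + 1) = x n + φ (x n) := fun n => Function.iterate_succ_apply' _ _ _
  have hx0 : x 0 = x₀ := rfl
  have hX0 : X ≤ x₀ := le_max_left _ _
  have hmain : ∀ n, x₀ ≤ x n ∧ φ x₀ ≤ φ (x n) ∧ x₀ + n * φ x₀ ≤ x n ∧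
      |(φ (x n) - ρ * x n) - (φ x₀ - ρ * x₀)| ≤ ε * (x n - x₀) := by
    intro n
    induction n with
    | zero => simp [hx0]
    | succ k ih =>
      obtain ⟨i1, i2, i3, i4⟩ := ih
      have hk := hX _ (hX0.trans i1)
      have hs := hstep _ (hX0.trans i1) 1 (by simp)
      rw [one_mul, ← hxs] at hs
      have hp := hk.1
      have e := hxs k
      refine ⟨by linarith, ?_, ?_, ?_⟩
      · have := (abs_le.1 hs).1
        nlinarith
      · push_cast
        linarith
      · rw [abs_le] at *
        constructor <;> nlinarith
  have hp0 : 0 < φ x₀ := (hX _ hX0).1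
  have hbound : ∀ y ≥ x₀, |(φ y - ρ * y) - (φ x₀ - ρ * x₀)| ≤ ε * (1 + C) * y := by
    intro y hy
    obtain ⟨n, hn1, hn2⟩ : ∃ n, x n ≤ y ∧ y < x (n + 1) := by
      have hex : ∃ n, y < x n := by
        obtain ⟨n, hn⟩ := exists_nat_gt ((y - x₀) / φ x₀)
        rw [div_lt_iff₀ hp0] at hn
        exact ⟨n, by linarith [(hmain n).2.2.1]⟩
      classical
      obtain ⟨m, hm⟩ : ∃ m, Nat.find hex = m + 1 := by
        refine Nat.exists_eq_succ_of_ne_zero fun h0 => ?_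
        have := Nat.find_spec hex
        rw [h0, hx0] at this
        linarith
      exact ⟨m, not_lt.1 (Nat.find_min hex (by omega)), hm ▸ Nat.find_spec hex⟩
    obtain ⟨i1, i2, -, i4⟩ := hmain n
    obtain ⟨hp, hb, -⟩ := hX _ (hX0.trans i1)
    have hx1 : 1 ≤ x₀ := le_max_right _ _
    rw [Real.norm_eq_abs, Real.norm_eq_abs, abs_of_pos hp, abs_of_pos (by linarith)] at hb
    have ht := hstep _ (hX0.trans i1) ((y - x n) / φ (x n))
      ⟨div_nonneg (by linarith) hp.le, (div_le_one hp).2 (by linarith [hxs n])⟩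
    rw [div_mul_cancel₀ _ hp.ne', add_sub_cancel] at ht
    have h1 : ε * (x n - x₀) + ε * φ (x n) ≤ ε * (1 + C) * y := by
      have : C * x n ≤ C * y := by gcongr
      have : x n - x₀ + φ (x n) ≤ (1 + C) * y := by linarith
      nlinarith
    rw [abs_le] at *
    constructor <;> linarith
  set D := |φ x₀ - ρ * x₀|
  refine ⟨max x₀ (2 * D / η + 1), fun y hy => ?_⟩
  have hy1 : x₀ ≤ y := (le_max_left _ _).trans hy
  have hy0 : 0 < y := by linarith [le_max_right X 1]
  have hy2 : 2 * D / η < y := by linarith [(le_max_right x₀ (2 * D / η + 1)).trans hy]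
  rw [div_lt_iff₀ hη] at hy2
  have hb := hbound y hy1
  rw [Real.dist_eq, show φ y / y - ρ = (φ y - ρ * y) / y by field_simp, abs_div, abs_of_pos hy0,
    div_lt_iff₀ hy0]
  have h2 := abs_sub_abs_le_abs_sub (φ y - ρ * y) (φ x₀ - ρ * x₀)
  have h3 : ε * (1 + C) * y ≤ η / 2 * y := by gcongr
  linarith

theorem BaireMeasurableSet.eventually_exists_affine_mem {V : Set ℝ} (hV : BaireMeasurableSet V)
    (hVm : ¬ IsMeagre V) {α β : ℕ → ℝ} (hα : Tendsto α atTop (𝓝 0))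
    (hβ : Tendsto β atTop (𝓝 1)) : ∀ᶠ n in atTop, ∃ t ∈ V, α n + β n * t ∈ V := by
  obtain ⟨U, hUo, hVU⟩ := hV.residualEq_isOpen
  rw [eventuallyEq_set] at hVU
  obtain ⟨t₀, ht₀⟩ : U.Nonempty := by
    by_contra hne
    rw [Set.not_nonempty_iff_eq_empty] at hne
    apply hVm
    filter_upwards [hVU] with t ht
    simpa [hne] using ht
  have hlim : Tendsto (fun n => α n + β n * t₀) atTop (𝓝 t₀) := by
    simpa using hα.add (hβ.mul_const t₀)
  filter_upwards [hlim (hUo.mem_nhds ht₀), hβ.eventually_ne one_ne_zero] with n hn hn0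
  let e : ℝ ≃ₜ ℝ := (Homeomorph.mulLeft₀ (β n) hn0).trans (Homeomorph.addLeft (α n))
  have he : ∀ t, e t = α n + β n * t := fun t => rfl
  have h2 := (tendsto_residual_of_isOpenMap e.continuous e.isOpenMap).eventually hVU
  obtain ⟨t, ⟨htU, hteU⟩, ht1, ht2⟩ := (dense_of_mem_residual (hVU.and h2)).inter_open_nonempty
    (U ∩ e ⁻¹' U) (hUo.inter (hUo.preimage e.continuous)) ⟨t₀, ht₀, hn⟩
  exact ⟨t, ht1.2 htU, ht2.2 hteU⟩

theorem BaireFun.baireMeasurableSet_abs_sub_lt {h : ℝ → ℝ} (hB : BaireFun h) (x a c ε : ℝ)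
    (ha : 0 < a) : BaireMeasurableSet {t | |h (x + t * a) - h x - c| < ε} := by
  have h1 := hB (Metric.ball (h x + c) ε) Metric.isOpen_ball
  let e : ℝ ≃ₜ ℝ := (Homeomorph.mulRight₀ a ha.ne').trans (Homeomorph.addLeft x)
  have h2 := h1.preimage e.continuous e.isOpenMap
  convert h2 using 1
  ext t
  have he : e t = x + t * a := rfl
  simp only [Set.mem_ofPred_eq, Set.mem_preimage, Metric.mem_ball, Real.dist_eq, he, sub_sub]

section SlowOscillation

variable {φ h : ℝ → ℝ} {ρ : ℝ}

theorem exists_abs_sub_lt_of_tendsto_div_one (hρ : 0 < ρ) (hpos : ∀ᶠ x in atTop, 0 < φ x)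
    (hdiv : Tendsto (fun x => φ x / x) atTop (𝓝 ρ)) (hB : BaireFun h)
    {S : Set ℝ} (hSsub : S ⊆ Aphi φ h ρ) (hSbp : BaireMeasurableSet S) (hSnm : ¬ IsMeagre S)
    {x w : ℕ → ℝ} (hx : Tendsto x atTop atTop) (hwx : Tendsto (fun n => w n / x n) atTop (𝓝 1))
    {ε : ℝ} (hε : 0 < ε) : ∃ n, |h (w n) - h (x n)| < ε := by
  have hx0 : ∀ᶠ n in atTop, 0 < x n := hx.eventually_gt_atTop 0
  have hw : Tendsto w atTop atTop := by
    refine (hwx.pos_mul_atTop one_pos hx).congr' ?_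
    filter_upwards [hx0] with n hn
    field_simp
  have hw0 : ∀ᶠ n in atTop, 0 < w n := hw.eventually_gt_atTop 0
  obtain ⟨N, hN⟩ := eventually_atTop.1 ((hx.eventually hpos).and (hw.eventually hpos))
  let V : ℕ × ℚ → Set ℝ := fun p => S ∩ ⋂ n : {n : ℕ // N ≤ n ∧ p.1 ≤ n},
    ({t | |h (x n + t * φ (x n)) - h (x n) - p.2| < ε / 2} ∩
      {t | |h (w n + t * φ (w n)) - h (w n) - p.2| < ε / 2})
  have hVbp : ∀ p, BaireMeasurableSet (V p) := fun p =>
    hSbp.inter (.iInter fun n => (hB.baireMeasurableSet_abs_sub_lt _ _ _ _ (hN n n.2.1).1).inter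
      (hB.baireMeasurableSet_abs_sub_lt _ _ _ _ (hN n n.2.1).2))
  obtain ⟨p, hp⟩ : ∃ p, ¬ IsMeagre (V p) := by
    by_contra! hall
    refine hSnm ((isMeagre_iUnion hall).mono fun t ht => ?_)
    obtain ⟨-, L, hL⟩ := hSsub ht
    obtain ⟨q, hq⟩ := exists_rat_btwn (show L - ε / 2 < L + ε / 2 by linarith)
    have hq' : ∀ᶠ y in atTop, |h (y + t * φ y) - h y - q| < ε / 2 := by
      have h1 := (hL.sub_const (q : ℝ)).abs
      refine h1.eventually_lt_const (abs_lt.2 ⟨?_, ?_⟩) <;> linarith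
    obtain ⟨m, hm⟩ := eventually_atTop.1 ((hx.eventually hq').and (hw.eventually hq'))
    exact Set.mem_iUnion.2 ⟨(m, q), ht, Set.mem_iInter.2 fun n => hm n n.2.2⟩
  have hφx : Tendsto (fun n => φ (x n) / x n) atTop (𝓝 ρ) := hdiv.comp hx
  have hφw : Tendsto (fun n => φ (w n) / w n) atTop (𝓝 ρ) := hdiv.comp hw
  have hβ : Tendsto (fun n => φ (x n) / φ (w n)) atTop (𝓝 1) := by
    have h1 := (hφx.div hφw hρ.ne').div hwx one_ne_zero
    rw [div_self hρ.ne', div_one] at h1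
    refine h1.congr' ?_
    filter_upwards [hx0, hw0, eventually_ge_atTop N] with n h2 h3 h4
    have := (hN n h4).1
    have := (hN n h4).2
    simp only [Pi.div_apply]
    field_simp
  have hα : Tendsto (fun n => (x n - w n) / φ (w n)) atTop (𝓝 0) := by
    have h1 := ((hwx.inv₀ one_ne_zero).sub_const 1).div hφw hρ.ne'
    rw [inv_one, sub_self, zero_div] at h1
    refine h1.congr' ?_
    filter_upwards [hx0, hw0, eventually_ge_atTop N] with n h2 h3 h4
    have := (hN n h4).2
    simp only [Pi.div_apply]
    field_simp
  obtain ⟨n, ⟨t, ⟨-, ht⟩, -, ht'⟩, hnN, hnp⟩ := (((hVbp p).eventually_exists_affine_mem hp hα hβ).and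
    ((eventually_ge_atTop N).and (eventually_ge_atTop p.1))).exists
  have h1 := (Set.mem_iInter.1 ht ⟨n, hnN, hnp⟩).1
  have h2 := (Set.mem_iInter.1 ht' ⟨n, hnN, hnp⟩).2
  simp only [Set.mem_ofPred_eq] at h1 h2
  have hpw := (hN n hnN).2
  have e : w n + ((x n - w n) / φ (w n) + φ (x n) / φ (w n) * t) * φ (w n)
      = x n + t * φ (x n) := by
    field_simp
    ring
  rw [e] at h2
  refine ⟨n, ?_⟩
  rw [abs_lt] at *
  constructor <;> linarith

theorem slowly_oscillating (hρ : 0 < ρ) (hpos : ∀ᶠ x in atTop, 0 < φ x)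
    (hdiv : Tendsto (fun x => φ x / x) atTop (𝓝 ρ)) (hB : BaireFun h)
    {S : Set ℝ} (hSsub : S ⊆ Aphi φ h ρ) (hSbp : BaireMeasurableSet S) (hSnm : ¬ IsMeagre S)
    {ε : ℝ} (hε : 0 < ε) :
    ∃ δ > 0, ∃ X, ∀ x ≥ X, ∀ w, |w / x - 1| < δ → |h w - h x| < ε := by
  by_contra! hcon
  choose x hx w hw hwx using fun n : ℕ => hcon (1 / (n + 1)) (by positivity) n
  have hx' : Tendsto x atTop atTop := tendsto_atTop_mono hx tendsto_natCast_atTop_atTop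
  have hw' : Tendsto (fun n => w n / x n) atTop (𝓝 1) :=
    tendsto_iff_dist_tendsto_zero.2 (squeeze_zero (fun _ => dist_nonneg) (fun n => (hw n).le)
      tendsto_one_div_add_atTop_nhds_zero_nat)
  obtain ⟨n, hn⟩ :=
    exists_abs_sub_lt_of_tendsto_div_one hρ hpos hdiv hB hSsub hSbp hSnm hx' hw' hε
  exact (hwx n).not_gt hn

end SlowOscillation

/-- The limit of `h (y_x) - h x` only depends on the asymptotic ratio of `y_x` to `x`. -/
theorem tendsto_sub_of_slowly_oscillating {h : ℝ → ℝ}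
    (hso : ∀ ε > 0, ∃ δ > 0, ∃ X, ∀ x ≥ X, ∀ w, |w / x - 1| < δ → |h w - h x| < ε)
    {f g : ℝ → ℝ} {a : ℝ} (ha : 0 < a) (hf : Tendsto (fun x => f x / x) atTop (𝓝 a))
    (hg : Tendsto (fun x => g x / x) atTop (𝓝 a)) {L : ℝ}
    (hL : Tendsto (fun x => h (f x) - h x) atTop (𝓝 L)) :
    Tendsto (fun x => h (g x) - h x) atTop (𝓝 L) := by
  have hfx : Tendsto f atTop atTop := by
    refine (hf.pos_mul_atTop ha tendsto_id).congr' ?_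
    filter_upwards [eventually_gt_atTop 0] with x hx
    simp only [id]
    field_simp
  have hgf : Tendsto (fun x => g x / f x) atTop (𝓝 1) := by
    have h1 := hg.div hf ha.ne'
    rw [div_self ha.ne'] at h1
    refine h1.congr' ?_
    filter_upwards [eventually_gt_atTop 0] with x hx
    simp only [Pi.div_apply]
    field_simp
  have h0 : Tendsto (fun x => h (g x) - h (f x)) atTop (𝓝 0) := by
    rw [Metric.tendsto_nhds]
    intro ε hε
    obtain ⟨δ, hδ, X, hX⟩ := hso ε hε
    filter_upwards [Metric.tendsto_nhds.1 hgf δ hδ, hfx.eventually_ge_atTop X] with x h1 h2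
    simpa [Real.dist_eq] using hX _ h2 _ h1
  simpa using (h0.add hL)

theorem tendsto_add_mul_div {φ : ℝ → ℝ} {ρ : ℝ}
    (hdiv : Tendsto (fun x => φ x / x) atTop (𝓝 ρ)) (t : ℝ) :
    Tendsto (fun x => (x + t * φ x) / x) atTop (𝓝 (1 + ρ * t)) := by
  refine ((hdiv.mul_const t).const_add 1).congr' ?_
  filter_upwards [eventually_gt_atTop 0] with x hx
  field_simp

/-- The additive group of those `s` for which `h (eˢ x) - h x` converges at infinity. -/
def convergenceSubgroup (h : ℝ → ℝ) : AddSubgroup ℝ where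
  carrier := {s | ∃ L, Tendsto (fun x => h (Real.exp s * x) - h x) atTop (𝓝 L)}
  zero_mem' := ⟨0, by simp⟩
  add_mem' := by
    rintro a b ⟨L, hL⟩ ⟨M, hM⟩
    refine ⟨L + M, ((hL.comp (tendsto_id.const_mul_atTop (Real.exp_pos b))).add hM).congr ?_⟩
    intro x
    simp [Real.exp_add, mul_assoc]
  neg_mem' := by
    rintro a ⟨L, hL⟩
    refine ⟨-L, (hL.comp (tendsto_id.const_mul_atTop (Real.exp_pos (-a)))).neg.congr ?_⟩
    intro x
    simp [← mul_assoc, ← Real.exp_add]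

theorem isClosed_convergenceSubgroup {h : ℝ → ℝ}
    (hso : ∀ ε > 0, ∃ δ > 0, ∃ X, ∀ x ≥ X, ∀ w, |w / x - 1| < δ → |h w - h x| < ε) :
    IsClosed (convergenceSubgroup h : Set ℝ) := by
  refine isClosed_of_closure_subset fun s hs => ?_
  suffices hc : Cauchy (map (fun x => h (Real.exp s * x) - h x) atTop) from
    CompleteSpace.complete hc
  rw [Metric.cauchy_iff]
  refine ⟨inferInstance, fun ε hε => ?_⟩
  obtain ⟨δ, hδ, X, hX⟩ := hso (ε / 4) (by positivity)
  have hcont : ∀ᶠ r in 𝓝 s, |Real.exp s / Real.exp r - 1| < δ := by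
    have : Tendsto (fun r => |Real.exp s / Real.exp r - 1|) (𝓝 s) (𝓝 0) := by
      have h1 : Continuous fun r => |Real.exp s / Real.exp r - 1| := by
        simp only [← Real.exp_sub]
        fun_prop
      simpa using h1.tendsto s
    exact this.eventually_lt_const hδ
  obtain ⟨r, ⟨L, hL⟩, hr⟩ := ((mem_closure_iff_frequently.1 hs).and_eventually hcont).exists
  have hev : ∀ᶠ x in atTop, |h (Real.exp s * x) - h x - L| < ε / 2 := by
    filter_upwards [Metric.tendsto_nhds.1 hL (ε / 4) (by positivity),
      (tendsto_id.const_mul_atTop (Real.exp_pos r)).eventually_ge_atTop X,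
      eventually_gt_atTop 0] with x h1 h2 h3
    have h4 := hX _ h2 (Real.exp s * x) (by
      rwa [id, mul_div_mul_right _ _ h3.ne'])
    rw [Real.dist_eq] at h1
    simp only [id] at h4
    rw [abs_lt] at *
    constructor <;> linarith
  refine ⟨{y | |y - L| < ε / 2}, hev, fun y hy z hz => ?_⟩
  simp only [Set.mem_ofPred_eq] at hy hz
  rw [Real.dist_eq]
  rw [abs_lt] at *
  constructor <;> linarith

theorem AddSubgroup.countable_of_eq_closure_singleton {G : Type*} [AddGroup G] {H : AddSubgroup G}
    {a : G} (hH : H = AddSubgroup.closure {a}) : (H : Set G).Countable := by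
  refine (Set.countable_range fun n : ℤ => n • a).mono fun x hx => ?_
  rw [SetLike.mem_coe, hH, AddSubgroup.mem_closure_singleton] at hx
  exact hx

theorem Set.Countable.isMeagre_real {s : Set ℝ} (hs : s.Countable) : IsMeagre s := by
  have := isMeagre_biUnion hs (f := fun x : ℝ => {x}) fun x _ =>
    IsNowhereDense.isMeagre (by simp [IsNowhereDense])
  simpa using this

/-- Theorem 5 (Dichotomy): for `φ ∈ SE` with index `ρ > 0` and `h` Baire, if
`A^φ` contains a non-meagre set with the Baire property, then
`A^φ = G₊^ρ = (−1/ρ, ∞)` and the limit function `K` is `c log(1 + ρu)` for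
some constant `c` (hence a continuous homomorphism from `(G₊^ρ, ∘ᵨ)` to `(ℝ,+)`). -/
theorem dichotomy_baire (φ : ℝ → ℝ) (ρ : ℝ) (hρ : 0 < ρ)
    (hφ : IsSelfEquivarying φ ρ) (h : ℝ → ℝ) (hB : BaireFun h)
    (K : ℝ → ℝ)
    (hK : ∀ t ∈ Aphi φ h ρ,
      Tendsto (fun x => h (x + t * φ x) - h x) atTop (nhds (K t)))
    (S : Set ℝ) (hSsub : S ⊆ Aphi φ h ρ)
    (hSbp : BaireMeasurableSet S) (hSnm : ¬ IsMeagre S) :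
    Aphi φ h ρ = Set.Ioi (-1 / ρ) ∧
    ∃ c : ℝ, ∀ u : ℝ, -1 / ρ < u → K u = c * Real.log (1 + ρ * u) := by
  have hdiv := hφ.tendsto_div hρ
  have hso : ∀ ε > 0, ∃ δ > 0, ∃ X, ∀ x ≥ X, ∀ w, |w / x - 1| < δ → |h w - h x| < ε :=
    fun ε hε => slowly_oscillating hρ hφ.1 hdiv hB hSsub hSbp hSnm hε
  have hexp : ∀ a : ℝ, Tendsto (fun x => Real.exp a * x / x) atTop (𝓝 (Real.exp a)) := by
    intro a
    refine tendsto_const_nhds.congr' ?_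
    filter_upwards [eventually_gt_atTop 0] with x hx
    field_simp
  have hiff : ∀ t, 0 < 1 + ρ * t → ∀ L,
      (Tendsto (fun x => h (x + t * φ x) - h x) atTop (𝓝 L) ↔
        Tendsto (fun x => h (Real.exp (Real.log (1 + ρ * t)) * x) - h x) atTop (𝓝 L)) := by
    intro t ht L
    have h1 := tendsto_add_mul_div hdiv t
    have h2 := hexp (Real.log (1 + ρ * t))
    rw [Real.exp_log ht] at h2 ⊢
    exact ⟨tendsto_sub_of_slowly_oscillating hso ht h1 h2,
      tendsto_sub_of_slowly_oscillating hso ht h2 h1⟩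
  have htop : ∀ s, s ∈ convergenceSubgroup h := by
    rcases (convergenceSubgroup h).dense_or_cyclic with hd | ⟨a, ha⟩
    · intro s
      rw [← SetLike.mem_coe, ← (isClosed_convergenceSubgroup hso).closure_eq]
      exact hd s
    · refine absurd (((AddSubgroup.countable_of_eq_closure_singleton ha).image
        fun s => (Real.exp s - 1) / ρ).mono fun t ht => ?_).isMeagre_real hSnm
      obtain ⟨ht0, L, hL⟩ := hSsub ht
      refine ⟨Real.log (1 + ρ * t), ⟨L, (hiff t ht0 L).1 hL⟩, ?_⟩
      simp only [Real.exp_log ht0]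
      field_simp
      ring
  have hdom : ∀ u, -1 / ρ < u ↔ 0 < 1 + ρ * u := by
    intro u
    rw [div_lt_iff₀ hρ]
    constructor <;> intro <;> linarith
  have hA : Aphi φ h ρ = Set.Ioi (-1 / ρ) := by
    ext u
    rw [Set.mem_Ioi, hdom]
    refine ⟨fun hu => hu.1, fun hu => ⟨hu, ?_⟩⟩
    obtain ⟨L, hL⟩ := htop (Real.log (1 + ρ * u))
    exact ⟨L, (hiff u hu L).2 hL⟩
  refine ⟨hA, ?_⟩
  choose k hk using htop
  let f : ℝ →+ ℝ := AddMonoidHom.mk' k fun a b => by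
    refine tendsto_nhds_unique (hk (a + b))
      (((hk a).comp (tendsto_id.const_mul_atTop (Real.exp_pos b))).add (hk b) |>.congr fun x => ?_)
    simp [Real.exp_add, mul_assoc]
  have hf : Continuous f := by
    refine continuous_of_continuousAt_zero f ?_
    rw [ContinuousAt, map_zero, Metric.tendsto_nhds]
    intro ε hε
    obtain ⟨δ, hδ, X, hX⟩ := hso (ε / 2) (by positivity)
    have h1 : ∀ᶠ s in 𝓝 (0 : ℝ), |Real.exp s - 1| < δ := by
      have h2 : Continuous fun s => |Real.exp s - 1| := by fun_prop
      refine (h2.tendsto 0).eventually_lt_const (by simpa using hδ)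
    filter_upwards [h1] with s hs
    have h3 : |k s| ≤ ε / 2 := by
      refine le_of_tendsto (hk s).abs ?_
      filter_upwards [eventually_ge_atTop X, eventually_gt_atTop 0] with x hx hx0
      exact (hX x hx _ (by rwa [mul_div_cancel_right₀ _ hx0.ne'])).le
    rw [Real.dist_eq, sub_zero]
    exact h3.trans_lt (by linarith)
  refine ⟨k 1, fun u hu => ?_⟩
  have h1 : K u = k (Real.log (1 + ρ * u)) :=
    tendsto_nhds_unique ((hiff u ((hdom u).1 hu) _).1 (hK u (hA ▸ hu))) (hk _)
  have h2 := map_real_smul f hf (Real.log (1 + ρ * u)) 1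
  simp only [smul_eq_mul, mul_one] at h2
  rw [h1, mul_comm (k 1)]
  exact h2
end
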